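/- arXiv:1008.0713 — 2 statements merged into one kernel-verified Lean document; each statement's English description precedes it below -/
import Mathlib

section
/- The metric d induces the Fürstenberg topology T on ℤ: a set A ⊆ ℤ is open with respect to the metric d if and only if A ∈ T. In particular, (ℤ, T) is metrizable. -/
/-- The arithmetic progression `a + bℤ`. -/
def ap (a : ℤ) (b : ℕ) : Set ℤ := {x : ℤ | ∃ n : ℤ, x = a + b * n}

/-- A set is open in Fürstenberg's sense if each of its points is contained
in an arithmetic progression lying inside the set. -/
def FurstOpen (A : Set ℤ) : Prop := ∀ a ∈ A, ∃ b : ℕ, 1 ≤ b ∧ ap a b ⊆ A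

/-- Fürstenberg's topology on ℤ. -/
def T : TopologicalSpace ℤ where
  IsOpen := FurstOpen
  isOpen_univ := fun a _ => ⟨1, le_refl 1, fun _ _ => trivial⟩
  isOpen_inter := by
    rintro s t hs ht a ⟨has, hat⟩
    obtain ⟨b, hb, hbs⟩ := hs a has
    obtain ⟨c, hc, hct⟩ := ht a hat
    refine ⟨b * c, Nat.one_le_iff_ne_zero.2 (Nat.mul_ne_zero (by omega) (by omega)), ?_⟩
    rintro x ⟨n, hn⟩
    exact ⟨hbs ⟨(c : ℤ) * n, by rw [hn]; push_cast; ring⟩,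
           hct ⟨(b : ℤ) * n, by rw [hn]; push_cast; ring⟩⟩
  isOpen_sUnion := by
    rintro S hS a ⟨s, hsS, has⟩
    obtain ⟨b, hb, hsub⟩ := hS s hsS a has
    exact ⟨b, hb, fun x hx => ⟨s, hsS, hsub hx⟩⟩

/-- `fnorm n` : the reciprocal of the largest `k ≥ 1` such that `1, …, k` all divide `n`,
with `fnorm 0 = 0`. -/
noncomputable def fnorm (n : ℤ) : ℝ :=
  if n = 0 then 0
  else 1 / ((sSup {k : ℕ | 1 ≤ k ∧ ∀ j : ℕ, 1 ≤ j → j ≤ k → (j : ℤ) ∣ n} : ℕ) : ℝ)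

/-- The induced distance function `d(m,n) = ‖m - n‖`. -/
noncomputable def fdist (m n : ℤ) : ℝ := fnorm (m - n)

theorem exists_fnorm_eq {n : ℤ} (hn : n ≠ 0) :
    ∃ K : ℕ, 1 ≤ K ∧ fnorm n = 1 / (K : ℝ) ∧
      ∀ k : ℕ, 1 ≤ k → (k ≤ K ↔ ∀ j : ℕ, 1 ≤ j → j ≤ k → (j : ℤ) ∣ n) := by
  set S : Set ℕ := {k : ℕ | 1 ≤ k ∧ ∀ j : ℕ, 1 ≤ j → j ≤ k → (j : ℤ) ∣ n} with hS
  have hne : S.Nonempty := by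
    refine ⟨1, le_rfl, fun j h₁ h₂ => ?_⟩
    obtain rfl : j = 1 := le_antisymm h₂ h₁
    simp
  have hbdd : BddAbove S :=
    ⟨n.natAbs, fun k hk =>
      Nat.le_of_dvd (Int.natAbs_pos.2 hn) (Int.natCast_dvd.1 (hk.2 k hk.1 le_rfl))⟩
  have hmem : sSup S ∈ S := Nat.sSup_mem hne hbdd
  refine ⟨sSup S, hmem.1, by simp only [fnorm, if_neg hn, hS], fun k hk => ⟨fun h j h₁ h₂ => ?_,
    fun h => le_csSup hbdd ⟨hk, h⟩⟩⟩
  exact hmem.2 j h₁ (h₂.trans h)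

theorem fnorm_zero : fnorm 0 = 0 := if_pos rfl

theorem fnorm_pos {n : ℤ} (hn : n ≠ 0) : 0 < fnorm n := by
  obtain ⟨K, hK, h, -⟩ := exists_fnorm_eq hn
  rw [h]
  positivity

theorem fnorm_nonneg (n : ℤ) : 0 ≤ fnorm n := by
  rcases eq_or_ne n 0 with rfl | hn
  · exact fnorm_zero.ge
  · exact (fnorm_pos hn).le

theorem fnorm_le_one_div_iff {n : ℤ} {k : ℕ} (hk : 1 ≤ k) :
    fnorm n ≤ 1 / (k : ℝ) ↔ ∀ j : ℕ, 1 ≤ j → j ≤ k → (j : ℤ) ∣ n := by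
  rcases eq_or_ne n 0 with rfl | hn
  · simp [fnorm_zero]
  · obtain ⟨K, hK, h, hiff⟩ := exists_fnorm_eq hn
    rw [h, ← hiff k hk, one_div_le_one_div (by positivity) (by positivity), Nat.cast_le]

theorem fnorm_neg (n : ℤ) : fnorm (-n) = fnorm n := by
  simp only [fnorm, neg_eq_zero, dvd_neg]

theorem fnorm_add_le_max (m n : ℤ) : fnorm (m + n) ≤ max (fnorm m) (fnorm n) := by
  wlog hmn : fnorm m ≤ fnorm n generalizing m n
  · rw [add_comm, max_comm]
    exact this n m (le_of_not_ge hmn)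
  rw [max_eq_right hmn]
  rcases eq_or_ne n 0 with rfl | hn
  · simpa using hmn
  · obtain ⟨K, hK, h, -⟩ := exists_fnorm_eq hn
    have hm := (fnorm_le_one_div_iff hK).1 (hmn.trans h.le)
    have hn := (fnorm_le_one_div_iff hK).1 h.le
    rw [h, fnorm_le_one_div_iff hK]
    exact fun j h₁ h₂ => dvd_add (hm j h₁ h₂) (hn j h₁ h₂)

theorem fdist_comm (m n : ℤ) : fdist m n = fdist n m := by
  rw [fdist, fdist, ← fnorm_neg, neg_sub]

/-- The metric space structure on `ℤ` given by `fdist`. -/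
noncomputable abbrev fdistMetricSpace : MetricSpace ℤ where
  dist := fdist
  dist_self m := by simp [fdist, fnorm_zero]
  dist_comm := fdist_comm
  dist_triangle l m n := by
    have h := fnorm_add_le_max (l - m) (m - n)
    rw [sub_add_sub_cancel] at h
    exact h.trans (max_le_add_of_nonneg (fnorm_nonneg _) (fnorm_nonneg _))
  eq_of_dist_eq_zero {m n} h := by
    by_contra hmn
    exact (fnorm_pos (sub_ne_zero.2 hmn)).ne' h

theorem fdist_open_iff_furstOpen (A : Set ℤ) :
    (∀ a ∈ A, ∃ r : ℝ, 0 < r ∧ ∀ x : ℤ, fdist a x < r → x ∈ A) ↔ FurstOpen A := by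
  refine forall₂_congr fun a _ => ⟨?_, ?_⟩
  · rintro ⟨r, hr, hA⟩
    obtain ⟨k, hk⟩ := exists_nat_one_div_lt hr
    refine ⟨(k + 1).factorial, Nat.factorial_pos _, ?_⟩
    rintro x ⟨n, rfl⟩
    refine hA _ (lt_of_le_of_lt ?_ hk)
    rw [← Nat.cast_succ, fdist, fnorm_le_one_div_iff (Nat.succ_pos k), sub_add_cancel_left]
    exact fun j h₁ h₂ => (dvd_mul_of_dvd_left
      (Int.natCast_dvd_natCast.2 (Nat.dvd_factorial h₁ h₂)) n).neg_right
  · rintro ⟨b, hb, hA⟩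
    refine ⟨1 / b, by positivity, fun x hx => hA ?_⟩
    obtain ⟨c, hc⟩ := (fnorm_le_one_div_iff hb).1 hx.le b hb le_rfl
    exact ⟨-c, by linarith⟩

theorem metrizableSpace_of_metricSpace {X : Type*} (m : MetricSpace X) :
    @TopologicalSpace.MetrizableSpace X m.toUniformSpace.toTopologicalSpace :=
  inferInstance

/-- The metric `d` induces the Fürstenberg topology: a set is open for the metric `d`
iff it belongs to `T`.  In particular, `(ℤ, T)` is metrizable. -/
theorem fdist_induces_furstenberg_topology :
    (∀ A : Set ℤ,
      (∀ a ∈ A, ∃ r : ℝ, 0 < r ∧ ∀ x : ℤ, fdist a x < r → x ∈ A) ↔ T.IsOpen A) ∧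
    @TopologicalSpace.MetrizableSpace ℤ T := by
  suffices hT : fdistMetricSpace.toUniformSpace.toTopologicalSpace = T by
    exact ⟨fdist_open_iff_furstOpen, hT ▸ metrizableSpace_of_metricSpace fdistMetricSpace⟩
  refine TopologicalSpace.ext_iff.2 fun A => Iff.trans ?_ (fdist_open_iff_furstOpen A)
  refine (@Metric.isOpen_iff ℤ fdistMetricSpace.toPseudoMetricSpace A).trans ?_
  refine forall₂_congr fun a _ => exists_congr fun r => and_congr_right fun _ =>
    forall_congr' fun x => ?_
  rw [fdist_comm]
  rfl
end

section
/- In the topological space (ℤ, T) with the Fürstenberg topology, any two disjoint closed sets can be separated by disjoint open sets; that is, (ℤ, T) is a normal (T4) topological space. -/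
theorem mem_ap_self (a : ℤ) (b : ℕ) : a ∈ ap a b := ⟨0, by ring⟩

theorem mem_ap_iff_dvd {a x : ℤ} {b : ℕ} : x ∈ ap a b ↔ (b : ℤ) ∣ x - a :=
  exists_congr fun _ => sub_eq_iff_eq_add'.symm

open Topology in
theorem isOpen_ap (a : ℤ) {b : ℕ} (hb : 1 ≤ b) : IsOpen[T] (ap a b) := fun x hx =>
  ⟨b, hb, fun y hy => mem_ap_iff_dvd.2 <| by
    simpa using dvd_add (mem_ap_iff_dvd.1 hy) (mem_ap_iff_dvd.1 hx)⟩

open Topology in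
theorem isClosed_ap (a : ℤ) {b : ℕ} (hb : 1 ≤ b) : IsClosed[T] (ap a b) := by
  refine @IsClosed.mk ℤ T _ fun x hx => ⟨b, hb, fun y hy hya => hx ?_⟩
  rw [mem_ap_iff_dvd] at hy hya ⊢
  simpa using dvd_sub hya hy

theorem regularSpace_T : @RegularSpace ℤ T := by
  let _ : TopologicalSpace ℤ := T
  refine RegularSpace.of_exists_mem_nhds_isClosed_subset fun x s hs => ?_
  obtain ⟨u, hus, hu, hxu⟩ := mem_nhds_iff.1 hs
  obtain ⟨b, hb, hbu⟩ := hu x hxu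
  exact ⟨ap x b, (isOpen_ap x hb).mem_nhds (mem_ap_self x b), isClosed_ap x hb, hbu.trans hus⟩

theorem t1Space_T : @T1Space ℤ T := by
  let _ : TopologicalSpace ℤ := T
  refine t1Space_iff_exists_open.2 fun x y hxy => ?_
  have hb : 1 ≤ (y - x).natAbs + 1 := Nat.le_add_left _ _
  refine ⟨ap x _, isOpen_ap x hb, mem_ap_self _ _, fun hy => hxy ?_⟩
  have h := Int.eq_zero_of_dvd_of_natAbs_lt_natAbs (mem_ap_iff_dvd.1 hy) (by omega)
  omega

/-- In `(ℤ, T)` any two disjoint closed sets can be separated by disjoint open sets: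
the space is normal, indeed T4. -/
theorem furstenberg_normal : @NormalSpace ℤ T ∧ @T4Space ℤ T := by
  let _ : TopologicalSpace ℤ := T
  have _ : RegularSpace ℤ := regularSpace_T
  have _ : T1Space ℤ := t1Space_T
  exact ⟨inferInstance, inferInstance⟩
end
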